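/- Every binary linear code of length n at most 46 and dimension 5 in which every nonzero codeword has Hamming weight at least 22 and the Hamming weight of every codeword is even contains a codeword of Hamming weight exactly 24. -/

import Mathlib

open Finset

/-- Every coordinate vanishes on at least half of the elements of a linear code, so the total
weight of a code is at most half its length times its cardinality. -/
theorem two_mul_sum_hammingNorm_le {n : ℕ} {V : Type*} [AddCommGroup V] [Module (ZMod 2) V]
    [Fintype V] (f : V →ₗ[ZMod 2] (Fin n → ZMod 2)) :
    2 * ∑ v, hammingNorm (f v) ≤ Fintype.card V * n := by
  have hswap : ∑ v, hammingNorm (f v) = ∑ i : Fin n, #{v : V | f v i ≠ 0} := by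
    simp only [hammingNorm, card_filter]
    exact sum_comm
  have hcoord (i : Fin n) : 2 * #{v : V | f v i ≠ 0} ≤ Fintype.card V := by
    have hle : #{v : V | f v i ≠ 0} ≤ #{v : V | ¬ f v i ≠ 0} := by
      by_cases h : ∃ e, f e i ≠ 0
      · obtain ⟨e, he⟩ := h
        refine card_le_card_of_injOn (· + e) ?_ (add_left_injective e).injOn
        intro v hv
        simp only [coe_filter, mem_univ, true_and, Set.mem_ofPred_eq, map_add, Pi.add_apply,
          not_not] at hv ⊢
        generalize f v i = a at *
        generalize f e i = b at *
        revert a b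
        decide
      · push Not at h
        simp [h]
    have := card_filter_add_card_filter_not (s := (univ : Finset V)) (fun v => f v i ≠ 0)
    rw [card_univ] at this
    omega
  rw [hswap, mul_sum]
  refine (sum_le_sum fun i _ => hcoord i).trans ?_
  simp [mul_comm]

/-- The number of common nonzero coordinates of two binary vectors. -/
def overlap {n : ℕ} (x y : Fin n → ZMod 2) : ℕ := #{i | x i ≠ 0 ∧ y i ≠ 0}

theorem hammingNorm_add_add_two_mul_overlap {n : ℕ} (x y : Fin n → ZMod 2) :
    hammingNorm (x + y) + 2 * overlap x y = hammingNorm x + hammingNorm y := by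
  simp only [hammingNorm, overlap, card_filter, mul_sum, ← sum_add_distrib]
  refine sum_congr rfl fun i _ => ?_
  have key (a b : ZMod 2) : ((if a + b ≠ 0 then 1 else 0) + 2 * if a ≠ 0 ∧ b ≠ 0 then 1 else 0) =
      (if a ≠ 0 then 1 else 0) + if b ≠ 0 then 1 else 0 := by
    revert a b
    decide
  convert key (x i) (y i)
  rfl

theorem overlap_cast {n : ℕ} (x y : Fin n → ZMod 2) : (overlap x y : ZMod 2) = x ⬝ᵥ y := by
  simp only [overlap, card_filter, dotProduct, Nat.cast_sum]
  refine sum_congr rfl fun i _ => ?_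
  generalize x i = a
  generalize y i = b
  revert a b
  decide

theorem neg_one_pow_overlap_add {n : ℕ} (x y z : Fin n → ZMod 2) :
    (-1 : ℤ) ^ overlap (x + y) z = (-1) ^ overlap x z * (-1) ^ overlap y z := by
  rw [← pow_add]
  refine neg_one_pow_congr ?_
  rw [← ZMod.natCast_eq_zero_iff_even, ← ZMod.natCast_eq_zero_iff_even]
  simp [overlap_cast, add_dotProduct]

theorem neg_one_pow_half_hammingNorm_add {n : ℕ} {x y : Fin n → ZMod 2}
    (hx : 2 ∣ hammingNorm x) (hy : 2 ∣ hammingNorm y) :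
    (-1 : ℤ) ^ (hammingNorm (x + y) / 2) =
      (-1) ^ (hammingNorm x / 2) * (-1) ^ (hammingNorm y / 2) * (-1) ^ overlap x y := by
  have h := hammingNorm_add_add_two_mul_overlap x y
  rw [← pow_add, ← pow_add]
  refine neg_one_pow_congr ?_
  have : hammingNorm x / 2 + hammingNorm y / 2 + overlap x y =
      hammingNorm (x + y) / 2 + 2 * overlap x y := by omega
  rw [this]
  simp [Nat.even_add]

/-- The radical of a binary code: the codewords orthogonal to the whole code. -/
def codeRadical {n : ℕ} (C : Submodule (ZMod 2) (Fin n → ZMod 2)) : Submodule (ZMod 2) C where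
  carrier := {z | ∀ y : C, (y : Fin n → ZMod 2) ⬝ᵥ z = 0}
  zero_mem' := by simp
  add_mem' := by
    intro a b ha hb y
    simp [dotProduct_add, ha y, hb y]
  smul_mem' := by
    intro c a ha y
    simp [dotProduct_smul, ha y]

theorem neg_one_pow_overlap_of_mem {n : ℕ} {C : Submodule (ZMod 2) (Fin n → ZMod 2)} {z : C}
    (hz : z ∈ codeRadical C) (y : C) : (-1 : ℤ) ^ overlap (y : Fin n → ZMod 2) z = 1 := by
  refine Even.neg_one_pow ?_
  rw [← ZMod.natCast_eq_zero_iff_even, overlap_cast]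
  exact hz y

theorem sum_neg_one_pow_overlap_of_notMem {n : ℕ} {C : Submodule (ZMod 2) (Fin n → ZMod 2)}
    [Fintype C] {z : C} (hz : z ∉ codeRadical C) :
    ∑ y : C, (-1 : ℤ) ^ overlap (y : Fin n → ZMod 2) z = 0 := by
  obtain ⟨e, he⟩ : ∃ e : C, (e : Fin n → ZMod 2) ⬝ᵥ z ≠ 0 := by
    by_contra! h
    exact hz h
  have hodd : (-1 : ℤ) ^ overlap (e : Fin n → ZMod 2) z = -1 := by
    refine Odd.neg_one_pow ?_
    rwa [← Nat.not_even_iff_odd, ← ZMod.natCast_eq_zero_iff_even, overlap_cast]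
  have h := Equiv.sum_comp (Equiv.addRight e)
    (fun y : C => (-1 : ℤ) ^ overlap (y : Fin n → ZMod 2) z)
  simp only [Equiv.coe_addRight, Submodule.coe_add, neg_one_pow_overlap_add, hodd,
    mul_neg_one, sum_neg_distrib] at h
  linarith

/-- The square of the Gauss sum of the quadratic form given by half the weight modulo two on an even code. -/
theorem sq_sum_neg_one_pow_half_hammingNorm {n : ℕ} (C : Submodule (ZMod 2) (Fin n → ZMod 2))
    [Fintype C] [Fintype (codeRadical C)] (heven : ∀ c ∈ C, 2 ∣ hammingNorm c) :
    (∑ x : C, (-1 : ℤ) ^ (hammingNorm (x : Fin n → ZMod 2) / 2)) ^ 2 =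
      Fintype.card C *
        ∑ z : codeRadical C, (-1 : ℤ) ^ (hammingNorm ((z : C) : Fin n → ZMod 2) / 2) := by
  classical
  set χ : C → ℤ := fun x => (-1) ^ (hammingNorm (x : Fin n → ZMod 2) / 2) with hχ
  have hsq (x : C) : χ x * χ x = 1 := by
    simp [hχ, ← mul_pow]
  have hadd (x z : C) : χ x * χ (x + z) = χ z * (-1) ^ overlap (x : Fin n → ZMod 2) z := by
    have := neg_one_pow_half_hammingNorm_add (heven x x.2) (heven z z.2)
    calc χ x * χ (x + z)
        = χ x * (χ x * χ z * (-1) ^ overlap (x : Fin n → ZMod 2) z) := by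
          rw [← this]; rfl
      _ = (χ x * χ x) * (χ z * (-1) ^ overlap (x : Fin n → ZMod 2) z) := by ring
      _ = _ := by rw [hsq, one_mul]
  calc (∑ x, χ x) ^ 2 = ∑ x, ∑ y, χ x * χ y := by rw [sq, sum_mul_sum]
    _ = ∑ x, ∑ z, χ x * χ (x + z) :=
        sum_congr rfl fun x _ =>
          (Equiv.sum_comp (Equiv.addLeft x) (fun y => χ x * χ y)).symm
    _ = ∑ z, χ z * ∑ x : C, (-1) ^ overlap (x : Fin n → ZMod 2) z := by
        simp only [hadd, mul_sum]
        exact sum_comm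
    _ = ∑ z, if z ∈ codeRadical C then (Fintype.card C : ℤ) * χ z else 0 := by
        refine sum_congr rfl fun z _ => ?_
        split_ifs with hz
        · simp [neg_one_pow_overlap_of_mem hz, mul_comm]
        · rw [sum_neg_one_pow_overlap_of_notMem hz, mul_zero]
    _ = _ := by
        rw [← sum_filter, ← mul_sum]
        congr 1
        exact sum_subtype _ (by simp) χ

/-- On the radical the form is additive, so its character sum vanishes unless it is trivial. -/
theorem sum_codeRadical_eq_zero_or {n : ℕ} (C : Submodule (ZMod 2) (Fin n → ZMod 2))
    [Fintype (codeRadical C)] (heven : ∀ c ∈ C, 2 ∣ hammingNorm c) :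
    (∑ z : codeRadical C, (-1 : ℤ) ^ (hammingNorm ((z : C) : Fin n → ZMod 2) / 2) = 0) ∨
      ∀ z : codeRadical C, Even (hammingNorm ((z : C) : Fin n → ZMod 2) / 2) := by
  refine or_iff_not_imp_right.2 fun h => ?_
  push Not at h
  obtain ⟨e, he⟩ := h
  have hs := Equiv.sum_comp (Equiv.addRight e)
    (fun z : codeRadical C => (-1 : ℤ) ^ (hammingNorm ((z : C) : Fin n → ZMod 2) / 2))
  have hadd (z : codeRadical C) :
      (-1 : ℤ) ^ (hammingNorm (((z + e : codeRadical C) : C) : Fin n → ZMod 2) / 2) =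
        -(-1) ^ (hammingNorm ((z : C) : Fin n → ZMod 2) / 2) := by
    have := neg_one_pow_half_hammingNorm_add (heven _ (z : C).2) (heven _ (e : C).2)
    rw [neg_one_pow_overlap_of_mem e.2, (Nat.not_even_iff_odd.1 he).neg_one_pow] at this
    simpa using this
  simp only [Equiv.coe_addRight, hadd, sum_neg_distrib] at hs
  linarith

/-- Every even binary linear code of length at most 46 and dimension 5 in which
every nonzero codeword has Hamming weight at least 22 contains a codeword of
Hamming weight exactly 24. -/
theorem even_code_le46_5_22_has_weight_24
    (n : ℕ) (hn : n ≤ 46)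
    (C : Submodule (ZMod 2) (Fin n → ZMod 2))
    (hdim : Module.finrank (ZMod 2) C = 5)
    (hmin : ∀ c ∈ C, c ≠ 0 → 22 ≤ hammingNorm c)
    (heven : ∀ c ∈ C, 2 ∣ hammingNorm c) :
    ∃ c ∈ C, hammingNorm c = 24 := by
  classical
  by_contra! hno
  have : Fintype C := Fintype.ofFinite C
  have : Fintype (codeRadical C) := Fintype.ofFinite _
  have hcard : Fintype.card C = 32 := by
    rw [Module.card_eq_pow_finrank (K := ZMod 2), hdim, ZMod.card]; norm_num
  set S : ℤ := ∑ x : C, (-1 : ℤ) ^ (hammingNorm (x : Fin n → ZMod 2) / 2) with hS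
  have hweight (x : C) (hx : x ≠ 0) :
      25 + 3 * (-1 : ℤ) ^ (hammingNorm (x : Fin n → ZMod 2) / 2) ≤
        hammingNorm (x : Fin n → ZMod 2) := by
    have h1 := hmin x x.2 (by simpa using hx)
    have h2 := heven x x.2
    have h3 := hno x x.2
    rcases Nat.even_or_odd (hammingNorm (x : Fin n → ZMod 2) / 2) with h | h
    · rw [h.neg_one_pow]
      obtain ⟨k, hk⟩ := h
      omega
    · rw [h.neg_one_pow]
      omega
  have hS_le : S ≤ -12 := by
    have hup := two_mul_sum_hammingNorm_le C.subtype
    have hlow : ∑ x : C, (25 + 3 * (-1 : ℤ) ^ (hammingNorm (x : Fin n → ZMod 2) / 2)) ≤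
        ∑ x : C, ((hammingNorm (x : Fin n → ZMod 2) : ℤ) + if x = 0 then 28 else 0) := by
      refine sum_le_sum fun x _ => ?_
      by_cases hx : x = 0
      · simp [hx]
      · simpa [hx] using hweight x hx
    simp only [sum_add_distrib, ← mul_sum, ← hS, sum_const, card_univ, hcard, sum_ite_eq',
      mem_univ, if_true, ← Nat.cast_sum] at hlow
    simp only [hcard, Submodule.subtype_apply] at hup
    simp only [nsmul_eq_mul] at hlow
    push_cast at hlow
    zify at hup hn
    linarith
  have hsq := sq_sum_neg_one_pow_half_hammingNorm C heven
  rw [← hS, hcard] at hsq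
  rcases sum_codeRadical_eq_zero_or C heven with h0 | hrad
  · rw [h0] at hsq
    nlinarith
  · rw [sum_congr rfl fun z _ => (hrad z).neg_one_pow] at hsq
    simp only [sum_const, card_univ, nsmul_eq_mul, mul_one] at hsq
    have hup := two_mul_sum_hammingNorm_le (C.subtype ∘ₗ (codeRadical C).subtype)
    have hlow : ∑ _z : codeRadical C, 28 ≤ ∑ z : codeRadical C,
        (hammingNorm ((z : C) : Fin n → ZMod 2) + if z = 0 then 28 else 0) := by
      refine sum_le_sum fun z _ => ?_
      by_cases hz : z = 0
      · simp [hz]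
      · have := hweight z (by simpa using hz)
        rw [(hrad z).neg_one_pow] at this
        simp only [hz, if_false]
        omega
    simp only [sum_add_distrib, sum_const, card_univ, sum_ite_eq', mem_univ, if_true,
      smul_eq_mul] at hlow
    simp only [LinearMap.comp_apply, Submodule.subtype_apply] at hup
    have hle := Nat.mul_le_mul_left (Fintype.card (codeRadical C)) hn
    have hR : Fintype.card (codeRadical C) ≤ 5 := by omega
    have hS_ge : -12 ≤ S := by
      by_contra! h
      have : (Fintype.card (codeRadical C) : ℤ) ≤ 5 := by exact_mod_cast hR
      push_cast at hsq
      nlinarith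
    have hS_eq : S = -12 := le_antisymm hS_le hS_ge
    rw [hS_eq] at hsq
    push_cast at hsq
    omega
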